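/- Let g be a Lie algebra and M a g-module. For n ≥ 3, the Baer sum E + E' := ∇_M(E ⊕_g E') endows the set Opextⁿ(g, M) of equivalence classes of crossed n-fold extensions of g by M with the structure of an abelian group, with zero element the class of 0 → M = M → 0 → ⋯ → 0 → g = g → 0, and the inverse of the class of (0 → M →^f ⋯ → g → 0) given by the class of (0 → M →^{-f} ⋯ → g → 0). -/

import Mathlib

/-! Crossed `n`-fold extensions of a Lie algebra `g` by a `g`-module `M`, for `n = t + 2`.

The underlying data of a crossed `n`-fold extension
`0 → M → M_{n-1} → ⋯ → M₁ → L → g → 0` is recorded as follows: `L` is the Lie algebra,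
`V = M₁` is the `L`-module of the crossed module `(M₁, L, ∂₁)`, and `Mod i` for
`0 ≤ i ≤ t - 1` are the `g`-modules `M_{i+2}`, so that `Mod (t-1) = M_{n-1}`
(the family `Mod` is indexed by all of `ℕ`; indices `≥ t` are junk).  For uniformity the
module `M` itself is glued onto the top of the chain via a linear equivalence
`e : M ≃ₗ Mod t`, so that the map `f : M → M_{n-1}` of the extension is the composite of
`e` with the connecting map out of `Mod t` (`d (t-1)` if `t ≥ 1`, and `d2` if `t = 0`). -/

/-- The data of a crossed `(t+2)`-fold extension of `g` by `M`. -/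
structure LieCrossedExtData (K : Type) [Field K] (g : Type) [LieRing g] [LieAlgebra K g]
    (M : Type) [AddCommGroup M] [Module K M] [LieRingModule g M] [LieModule K g M]
    (t : ℕ) : Type 1 where
  L : Type
  [instLieRingL : LieRing L]
  [instLieAlgebraL : LieAlgebra K L]
  V : Type
  [instAddCommGroupV : AddCommGroup V]
  [instModuleV : Module K V]
  [instLieRingModuleV : LieRingModule L V]
  [instLieModuleV : LieModule K L V]
  Mod : ℕ → Type
  [instAddCommGroupMod : ∀ i, AddCommGroup (Mod i)]
  [instModuleMod : ∀ i, Module K (Mod i)]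
  [instLieRingModuleMod : ∀ i, LieRingModule g (Mod i)]
  [instLieModuleMod : ∀ i, LieModule K g (Mod i)]
  π : L →ₗ⁅K⁆ g
  d1 : V →ₗ[K] L
  d2 : Mod 0 →ₗ[K] V
  d : ∀ i : ℕ, Mod (i + 1) →ₗ[K] Mod i
  e : M ≃ₗ[K] Mod t

attribute [instance] LieCrossedExtData.instLieRingL LieCrossedExtData.instLieAlgebraL
  LieCrossedExtData.instAddCommGroupV LieCrossedExtData.instModuleV
  LieCrossedExtData.instLieRingModuleV LieCrossedExtData.instLieModuleV
  LieCrossedExtData.instAddCommGroupMod LieCrossedExtData.instModuleMod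
  LieCrossedExtData.instLieRingModuleMod LieCrossedExtData.instLieModuleMod

variable {K : Type} [Field K] {g : Type} [LieRing g] [LieAlgebra K g]
  {M : Type} [AddCommGroup M] [Module K M] [LieRingModule g M] [LieModule K g M]

/-- The axioms making such data a crossed `(t+2)`-fold extension of `g` by `M`:
`(V, L, ∂₁)` is a crossed module with cokernel `g`, the sequence is exact, all the maps
between `g`-modules are morphisms of `g`-modules (for `∂₂` this is expressed using lifts
along `π`), and the top map (which corresponds to `f : M → M_{n-1}`) is injective. -/
def IsLieCrossedExt {t : ℕ} (E : LieCrossedExtData K g M t) : Prop :=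
  -- (V, L, d1) is a crossed module: d1 is L-equivariant and ⁅∂v, w⁆ = -⁅∂w, v⁆
  (∀ (x : E.L) (v : E.V), E.d1 ⁅x, v⁆ = ⁅x, E.d1 v⁆) ∧
  (∀ v w : E.V, ⁅E.d1 v, w⁆ = - ⁅E.d1 w, v⁆) ∧
  -- π is onto and exactness holds at L
  Function.Surjective E.π ∧
  (∀ x : E.L, E.π x = 0 ↔ x ∈ LinearMap.range E.d1) ∧
  -- exactness at V = M₁
  (LinearMap.ker E.d1 = LinearMap.range E.d2) ∧
  -- exactness at the modules M₂, …, M_{n-1}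
  (1 ≤ t → LinearMap.ker E.d2 = LinearMap.range (E.d 0)) ∧
  (∀ j, j + 1 < t → LinearMap.ker (E.d j) = LinearMap.range (E.d (j + 1))) ∧
  -- injectivity of f : M → M_{n-1} (the map out of the copy of M on top)
  (t = 0 → Function.Injective E.d2) ∧
  (∀ k, k + 1 = t → Function.Injective (E.d k)) ∧
  -- d2, the d i and e are morphisms of g-modules
  (∀ (x : E.L) (m : E.Mod 0), E.d2 ⁅E.π x, m⁆ = ⁅x, E.d2 m⁆) ∧
  (∀ j, j < t → ∀ (x : g) (m : E.Mod (j + 1)), E.d j ⁅x, m⁆ = ⁅x, E.d j m⁆) ∧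
  (∀ (x : g) (m : M), E.e ⁅x, m⁆ = ⁅x, E.e m⁆)

/-- A morphism of crossed `(t+2)`-fold extensions inducing the identity on `g` and `M`:
the maps `β : L → L'` (a Lie algebra morphism), `δV = δ₁ : M₁ → M₁'` and
`δMod i : M_{i+2} → M_{i+2}'` make all squares commute, `(δ₁, β)` is a morphism of crossed
modules over the identity of `g`, and the `δMod i` are morphisms of `g`-modules. -/
def IsLieCrossedExtHom {t : ℕ} (E F : LieCrossedExtData K g M t)
    (β : E.L →ₗ⁅K⁆ F.L) (δV : E.V →ₗ[K] F.V)
    (δMod : ∀ i : ℕ, E.Mod i →ₗ[K] F.Mod i) : Prop :=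
  -- identity on g
  (∀ x : E.L, F.π (β x) = E.π x) ∧
  -- (δV, β) is a morphism of crossed modules
  (∀ v : E.V, F.d1 (δV v) = β (E.d1 v)) ∧
  (∀ (x : E.L) (v : E.V), δV ⁅x, v⁆ = ⁅β x, δV v⁆) ∧
  -- all the squares commute
  (∀ m : E.Mod 0, δV (E.d2 m) = F.d2 (δMod 0 m)) ∧
  (∀ j, j < t → ∀ m : E.Mod (j + 1), δMod j (E.d j m) = F.d j (δMod (j + 1) m)) ∧
  -- the δMod j are morphisms of g-modules
  (∀ j, j ≤ t → ∀ (x : g) (m : E.Mod j), δMod j ⁅x, m⁆ = ⁅x, δMod j m⁆) ∧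
  -- identity on M
  (∀ m : M, δMod t (E.e m) = F.e m)

section ZeroExtension

variable (K g M)

/-- The submodules of `M` used to build the zero extension: the quotient `M ⧸ zeroSub i`
is `M` at the top two spots of the chain and `0` below them. -/
def zeroSub (t i : ℕ) : LieSubmodule K g M := if t ≤ i + 1 then ⊥ else ⊤

theorem zeroSub_antitone (t i : ℕ) : zeroSub K g M t (i + 1) ≤ zeroSub K g M t i := by
  unfold zeroSub
  split_ifs with h1 h2
  · exact bot_le
  · exact bot_le
  · omega
  · exact le_rfl

/-- The zero crossed `(t+2)`-fold extension
`0 → M = M → 0 → ⋯ → 0 → g = g → 0` of `g` by `M`. -/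
def zeroExtData (t : ℕ) : LieCrossedExtData K g M t where
  L := g
  V := M ⧸ (⊤ : LieSubmodule K g M)
  Mod i := M ⧸ zeroSub K g M t i
  π := LieHom.id
  d1 := 0
  d2 := 0
  d i := Submodule.mapQ (zeroSub K g M t (i + 1)).toSubmodule
    (zeroSub K g M t i).toSubmodule LinearMap.id
    (fun x hx => zeroSub_antitone K g M t i hx)
  e := (Submodule.quotEquivOfEqBot (zeroSub K g M t t).toSubmodule
    (by simp [zeroSub])).symm

end ZeroExtension

section Opext

variable (K g M)

/-- A crossed `(t+2)`-fold extension of `g` by `M`. -/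
def LieCrossedExt (t : ℕ) : Type 1 :=
  {E : LieCrossedExtData K g M t // IsLieCrossedExt E}

/-- Two extensions are related if there is a morphism between them (inducing the identity
on `g` and `M`); the equivalence relation generated by this relation is the equivalence of
crossed extensions. -/
def lieCrossedExtRel (t : ℕ) (E F : LieCrossedExt K g M t) : Prop :=
  ∃ (β : E.1.L →ₗ⁅K⁆ F.1.L) (δV : E.1.V →ₗ[K] F.1.V)
    (δMod : ∀ i : ℕ, E.1.Mod i →ₗ[K] F.1.Mod i),
    IsLieCrossedExtHom E.1 F.1 β δV δMod

/-- `Opext^{t+2}(g, M)`: equivalence classes of crossed `(t+2)`-fold extensions. -/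
def Opext (t : ℕ) : Type 1 := Quot (lieCrossedExtRel K g M t)

end Opext

variable {t : ℕ}

/-- The extension `-E`, obtained by replacing `f : M → M_{n-1}` by `-f`. -/
def negExtData (E : LieCrossedExtData K g M t) : LieCrossedExtData K g M t :=
  { E with e := (LinearEquiv.neg K).trans E.e }

/-- `F` is a Baer sum of the crossed `(u+3)`-fold extensions `E` and `E'` (`n = u+3 ≥ 3`):
`F = ∇_M (E ⊕_g E')`, i.e. the Lie algebra of `F` is the fibered product `L ×_g L'`, its
`M₁` is `M₁ ⊕ M₁'` with the componentwise action, its intermediate modules are the direct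
sums `M_i ⊕ M_i'`, and its top module `M_{n-1}` is the pushout of
`f ⊕ f' : M ⊕ M → M_{n-1} ⊕ M'_{n-1}` along the codiagonal `∇_M`, all compatibly with the
structure maps. -/
def IsBaerSum (u : ℕ) (E E' F : LieCrossedExtData K g M (u + 1)) : Prop :=
  ∃ (jL : F.L →ₗ[K] E.L × E'.L)
    (eV : F.V ≃ₗ[K] E.V × E'.V)
    (eMod : ∀ i, i < u → (F.Mod i ≃ₗ[K] E.Mod i × E'.Mod i))
    (r : E.Mod u × E'.Mod u →ₗ[K] F.Mod u),
    -- F.L is the fibered product L ×_g L':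
    Function.Injective jL ∧
    (Set.range jL = {p : E.L × E'.L | E.π p.1 = E'.π p.2}) ∧
    (∀ x y : F.L, jL ⁅x, y⁆ = (⁅(jL x).1, (jL y).1⁆, ⁅(jL x).2, (jL y).2⁆)) ∧
    (∀ x : F.L, F.π x = E.π (jL x).1) ∧
    -- F.V is V ⊕ V' with the componentwise action, and F.∂₁ = (∂₁, ∂₁'):
    (∀ (x : F.L) (v : F.V), eV ⁅x, v⁆ = (⁅(jL x).1, (eV v).1⁆, ⁅(jL x).2, (eV v).2⁆)) ∧
    (∀ v : F.V, jL (F.d1 v) = (E.d1 (eV v).1, E'.d1 (eV v).2)) ∧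
    -- the intermediate modules of F are the direct sums, compatibly with the actions
    (∀ (i : ℕ) (h : i < u) (x : g) (m : F.Mod i),
      eMod i h ⁅x, m⁆ = (⁅x, (eMod i h m).1⁆, ⁅x, (eMod i h m).2⁆)) ∧
    -- ... with ∂₂ (where relevant, i.e. unless u = 0 and M₂ is the pushout):
    (∀ h0 : 0 < u, ∀ m : F.Mod 0,
      eV (F.d2 m) = (E.d2 (eMod 0 h0 m).1, E'.d2 (eMod 0 h0 m).2)) ∧
    (∀ hu : u = 0, ∀ p : E.Mod u × E'.Mod u,
      eV (F.d2 (cast (congrArg F.Mod hu) (r p))) =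
        (E.d2 (cast (congrArg E.Mod hu) p.1), E'.d2 (cast (congrArg E'.Mod hu) p.2))) ∧
    -- ... and with the connecting maps below the pushout level:
    (∀ (i : ℕ) (h : i + 1 < u) (m : F.Mod (i + 1)),
      eMod i (by omega) (F.d i m) =
        (E.d i (eMod (i + 1) h m).1, E'.d i (eMod (i + 1) h m).2)) ∧
    -- the top module of F is the pushout of f ⊕ f' along ∇_M, via the surjection r:
    Function.Surjective r ∧
    (∀ (x : g) (p : E.Mod u × E'.Mod u), r (⁅x, p.1⁆, ⁅x, p.2⁆) = ⁅x, r p⁆) ∧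
    (LinearMap.ker r = LinearMap.range
      (LinearMap.prod (((E.d u).comp (E.e : M →ₗ[K] E.Mod (u + 1))))
        (-((E'.d u).comp (E'.e : M →ₗ[K] E'.Mod (u + 1)))))) ∧
    -- the connecting map out of the pushout is induced by (∂, ∂'):
    (∀ (k : ℕ) (hk : k + 1 = u) (p : E.Mod u × E'.Mod u),
      eMod k (by omega) (F.d k (cast (congrArg F.Mod hk).symm (r p))) =
        (E.d k (cast (congrArg E.Mod hk).symm p.1),
         E'.d k (cast (congrArg E'.Mod hk).symm p.2))) ∧
    -- and the map f of F is m ↦ r (f m, 0):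
    (∀ m : M, F.d u (F.e m) = r (E.d u (E.e m), 0))

section Helpers

variable {A : Type} [AddCommGroup A] [Module K A] [LieRingModule g A] [LieModule K g A]
  {B : Type} [AddCommGroup B] [Module K B] [LieRingModule g B] [LieModule K g B]
  {C : Type} [AddCommGroup C] [Module K C] [LieRingModule g C] [LieModule K g C]
  {D : Type} [AddCommGroup D] [Module K D] [LieRingModule g D] [LieModule K g D]

/-- The componentwise action on a product of Lie modules. -/
instance prodLieRingModule : LieRingModule g (A × B) where
  bracket x p := (⁅x, p.1⁆, ⁅x, p.2⁆)
  add_lie x y p := Prod.ext (add_lie x y p.1) (add_lie x y p.2)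
  lie_add x p q := Prod.ext (lie_add x p.1 q.1) (lie_add x p.2 q.2)
  leibniz_lie x y p := Prod.ext (leibniz_lie x y p.1) (leibniz_lie x y p.2)

theorem prod_lie_apply (x : g) (p : A × B) : ⁅x, p⁆ = (⁅x, p.1⁆, ⁅x, p.2⁆) := rfl

instance prodLieModule : LieModule K g (A × B) where
  smul_lie r x p := Prod.ext (smul_lie r x p.1) (smul_lie r x p.2)
  lie_smul r x p := Prod.ext (lie_smul r x p.1) (lie_smul r x p.2)

/-- A morphism of crossed extensions of `g` inducing the identity on `g` and the map `φ` between
the coefficient modules. -/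
structure LieCrossedExtHomOver {t : ℕ} (φ : A →ₗ[K] B) (E : LieCrossedExtData K g A t)
    (F : LieCrossedExtData K g B t) where
  β : E.L →ₗ⁅K⁆ F.L
  δV : E.V →ₗ[K] F.V
  δMod : ∀ i : ℕ, E.Mod i →ₗ[K] F.Mod i
  π_β : ∀ x : E.L, F.π (β x) = E.π x
  d1_δV : ∀ v : E.V, F.d1 (δV v) = β (E.d1 v)
  δV_lie : ∀ (x : E.L) (v : E.V), δV ⁅x, v⁆ = ⁅β x, δV v⁆
  δV_d2 : ∀ m : E.Mod 0, δV (E.d2 m) = F.d2 (δMod 0 m)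
  δMod_d : ∀ j, j < t → ∀ m : E.Mod (j + 1), δMod j (E.d j m) = F.d j (δMod (j + 1) m)
  δMod_lie : ∀ j, j ≤ t → ∀ (x : g) (m : E.Mod j), δMod j ⁅x, m⁆ = ⁅x, δMod j m⁆
  δMod_e : ∀ m : A, δMod t (E.e m) = F.e (φ m)

namespace LieCrossedExtHomOver

variable {E : LieCrossedExtData K g A t} {F : LieCrossedExtData K g B t}
  {G : LieCrossedExtData K g C t}

/-- Composition of morphisms of crossed extensions. -/
def comp {ψ : B →ₗ[K] C} {φ : A →ₗ[K] B} (q : LieCrossedExtHomOver ψ F G)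
    (p : LieCrossedExtHomOver φ E F) : LieCrossedExtHomOver (ψ ∘ₗ φ) E G where
  β := q.β.comp p.β
  δV := q.δV ∘ₗ p.δV
  δMod i := q.δMod i ∘ₗ p.δMod i
  π_β x := by simp [q.π_β, p.π_β]
  d1_δV v := by simp [q.d1_δV, p.d1_δV]
  δV_lie x v := by simp [q.δV_lie, p.δV_lie]
  δV_d2 m := by simp [q.δV_d2, p.δV_d2]
  δMod_d j hj m := by simp [q.δMod_d j hj, p.δMod_d j hj]
  δMod_lie j hj x m := by simp [q.δMod_lie j hj, p.δMod_lie j hj]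
  δMod_e m := by simp [q.δMod_e, p.δMod_e]

/-- Replacing the map on coefficients by an equal one. -/
def congr {φ φ' : A →ₗ[K] B} (p : LieCrossedExtHomOver φ E F) (h : ∀ a, φ a = φ' a) :
    LieCrossedExtHomOver φ' E F where
  __ := p
  δMod_e m := by rw [p.δMod_e, h]

theorem rel {E F : LieCrossedExt K g M t} (p : LieCrossedExtHomOver LinearMap.id E.1 F.1) :
    lieCrossedExtRel K g M t E F :=
  ⟨p.β, p.δV, p.δMod, p.π_β, p.d1_δV, p.δV_lie, p.δV_d2, p.δMod_d, p.δMod_lie, p.δMod_e⟩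

theorem nonempty_of_rel {E F : LieCrossedExt K g M t} (h : lieCrossedExtRel K g M t E F) :
    Nonempty (LieCrossedExtHomOver LinearMap.id E.1 F.1) := by
  obtain ⟨β, δV, δMod, h1, h2, h3, h4, h5, h6, h7⟩ := h
  exact ⟨β, δV, δMod, h1, h2, h3, h4, h5, h6, h7⟩

end LieCrossedExtHomOver

section DirectSum

variable (E : LieCrossedExtData K g A t) (F : LieCrossedExtData K g B t)

/-- The fibered product `L ×_g L'`. -/
def fiberedProduct : LieSubalgebra K (E.L × F.L) where
  carrier := {p | E.π p.1 = F.π p.2}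
  add_mem' {a b} ha hb := by
    simp only [Set.mem_ofPred_eq, Prod.fst_add, Prod.snd_add, map_add] at *
    rw [ha, hb]
  zero_mem' := by simp
  smul_mem' c a ha := by
    simp only [Set.mem_ofPred_eq, Prod.smul_fst, Prod.smul_snd, map_smul] at *
    rw [ha]
  lie_mem' {a b} ha hb := by
    change E.π a.1 = F.π a.2 at ha
    change E.π b.1 = F.π b.2 at hb
    change E.π ⁅a.1, b.1⁆ = F.π ⁅a.2, b.2⁆
    rw [LieHom.map_lie, LieHom.map_lie, ha, hb]

theorem mem_fiberedProduct {E : LieCrossedExtData K g A t} {F : LieCrossedExtData K g B t}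
    {p : E.L × F.L} : p ∈ fiberedProduct E F ↔ E.π p.1 = F.π p.2 := Iff.rfl

/-- The componentwise action of `L ×_g L'` on `V × V'`. -/
instance fiberedProductLieRingModule : LieRingModule (fiberedProduct E F) (E.V × F.V) where
  bracket x v := (⁅x.1.1, v.1⁆, ⁅x.1.2, v.2⁆)
  add_lie x y p := Prod.ext (add_lie x.1.1 y.1.1 p.1) (add_lie x.1.2 y.1.2 p.2)
  lie_add x p q := Prod.ext (lie_add x.1.1 p.1 q.1) (lie_add x.1.2 p.2 q.2)
  leibniz_lie x y p :=
    Prod.ext (leibniz_lie x.1.1 y.1.1 p.1) (leibniz_lie x.1.2 y.1.2 p.2)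

instance fiberedProductLieModule : LieModule K (fiberedProduct E F) (E.V × F.V) where
  smul_lie r x p := Prod.ext (smul_lie r x.1.1 p.1) (smul_lie r x.1.2 p.2)
  lie_smul r x p := Prod.ext (lie_smul r x.1.1 p.1) (lie_smul r x.1.2 p.2)

/-- The direct sum `E ⊕_g F` of crossed extensions, an extension of `g` by `A × B`, where `hE`
and `hF` ensure that the boundary maps land in the fibered product. -/
def directSumExtData (hE : IsLieCrossedExt E) (hF : IsLieCrossedExt F) :
    LieCrossedExtData K g (A × B) t where
  L := fiberedProduct E F
  V := E.V × F.V
  Mod i := E.Mod i × F.Mod i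
  π := E.π.comp ((LieHom.fst K E.L F.L).comp (fiberedProduct E F).incl)
  d1 := (E.d1.prodMap F.d1).codRestrict (fiberedProduct E F).toSubmodule fun v => by
    have h1 := (hE.2.2.2.1 (E.d1 v.1)).2 ⟨_, rfl⟩
    have h2 := (hF.2.2.2.1 (F.d1 v.2)).2 ⟨_, rfl⟩
    exact h1.trans h2.symm
  d2 := E.d2.prodMap F.d2
  d i := (E.d i).prodMap (F.d i)
  e := E.e.prodCongr F.e

end DirectSum

theorem isLieCrossedExt_directSumExtData {E : LieCrossedExtData K g A t}
    {F : LieCrossedExtData K g B t} (hE : IsLieCrossedExt E) (hF : IsLieCrossedExt F) :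
    IsLieCrossedExt (directSumExtData E F hE hF) := by
  obtain ⟨a1, a2, a3, a4, a5, a6, a7, a8, a9, a10, a11, a12⟩ := id hE
  obtain ⟨b1, b2, b3, b4, b5, b6, b7, b8, b9, b10, b11, b12⟩ := id hF
  refine ⟨?_, ?_, ?_, ?_, ?_, ?_, ?_, ?_, ?_, ?_, ?_, ?_⟩
  · rintro ⟨x, hx⟩ v
    exact Subtype.ext (Prod.ext (a1 _ _) (b1 _ _))
  · intro v w
    exact Prod.ext (a2 _ _) (b2 _ _)
  · intro z
    obtain ⟨x, hx⟩ := a3 z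
    obtain ⟨y, hy⟩ := b3 z
    exact ⟨⟨(x, y), hx.trans hy.symm⟩, hx⟩
  · rintro ⟨⟨x, y⟩, h⟩
    constructor
    · intro h0
      have hx : E.π x = 0 := h0
      have hy : F.π y = 0 := (show E.π x = F.π y from h).symm.trans hx
      obtain ⟨v, rfl⟩ := (a4 _).1 hx
      obtain ⟨w, rfl⟩ := (b4 _).1 hy
      exact ⟨(v, w), rfl⟩
    · rintro ⟨v, hv⟩
      have : E.d1 v.1 = x := congrArg (fun p => p.1.1) hv
      exact (a4 x).2 ⟨_, this⟩
  · refine (LinearMap.ker_codRestrict (fiberedProduct E F).toSubmodule (E.d1.prodMap F.d1) _).trans ?_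
    change _ = LinearMap.range (E.d2.prodMap F.d2)
    rw [LinearMap.ker_prodMap, LinearMap.range_prodMap, a5, b5]
  · intro h
    change LinearMap.ker (E.d2.prodMap F.d2) = LinearMap.range ((E.d 0).prodMap (F.d 0))
    rw [LinearMap.ker_prodMap, LinearMap.range_prodMap, a6 h, b6 h]
  · intro j h
    change LinearMap.ker ((E.d j).prodMap (F.d j)) =
      LinearMap.range ((E.d (j + 1)).prodMap (F.d (j + 1)))
    rw [LinearMap.ker_prodMap, LinearMap.range_prodMap, a7 j h, b7 j h]
  · intro h
    exact (a8 h).prodMap (b8 h)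
  · intro k h
    exact (a9 k h).prodMap (b9 k h)
  · rintro ⟨⟨x, y⟩, h⟩ ⟨m, n⟩
    refine Prod.ext (a10 x m) ?_
    change F.d2 ⁅E.π x, n⁆ = ⁅y, F.d2 n⁆
    rw [show E.π x = F.π y from h, b10]
  · intro j h x m
    exact Prod.ext (a11 j h x m.1) (b11 j h x m.2)
  · intro x m
    exact Prod.ext (a12 x m.1) (b12 x m.2)

section DirectSumHoms

variable {E : LieCrossedExtData K g A t} {F : LieCrossedExtData K g B t}
  {E' : LieCrossedExtData K g C t} {F' : LieCrossedExtData K g D t}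

/-- Functoriality of the direct sum of crossed extensions. -/
def LieCrossedExtHomOver.prodMap {hE : IsLieCrossedExt E} {hF : IsLieCrossedExt F}
    {hE' : IsLieCrossedExt E'} {hF' : IsLieCrossedExt F'}
    {φ : A →ₗ[K] C} {ψ : B →ₗ[K] D} (p : LieCrossedExtHomOver φ E E')
    (q : LieCrossedExtHomOver ψ F F') :
    LieCrossedExtHomOver (φ.prodMap ψ) (directSumExtData E F hE hF)
      (directSumExtData E' F' hE' hF') where
  β :=
    { toFun := fun x => ⟨(p.β x.1.1, q.β x.1.2),
        (p.π_β x.1.1).trans (Eq.trans x.2 (q.π_β x.1.2).symm)⟩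
      map_add' := fun _ _ => Subtype.ext (Prod.ext (map_add p.β _ _) (map_add q.β _ _))
      map_smul' := fun _ _ => Subtype.ext (Prod.ext (map_smul p.β _ _) (map_smul q.β _ _))
      map_lie' := fun {_ _} =>
        Subtype.ext (Prod.ext (LieHom.map_lie p.β _ _) (LieHom.map_lie q.β _ _)) }
  δV := p.δV.prodMap q.δV
  δMod i := (p.δMod i).prodMap (q.δMod i)
  π_β x := p.π_β x.1.1
  d1_δV v := Subtype.ext (Prod.ext (p.d1_δV v.1) (q.d1_δV v.2))
  δV_lie x v := Prod.ext (p.δV_lie x.1.1 v.1) (q.δV_lie x.1.2 v.2)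
  δV_d2 m := Prod.ext (p.δV_d2 m.1) (q.δV_d2 m.2)
  δMod_d j hj m := Prod.ext (p.δMod_d j hj m.1) (q.δMod_d j hj m.2)
  δMod_lie j hj x m := Prod.ext (p.δMod_lie j hj x m.1) (q.δMod_lie j hj x m.2)
  δMod_e m := Prod.ext (p.δMod_e m.1) (q.δMod_e m.2)

/-- The morphism to a direct sum of crossed extensions induced by two morphisms. -/
def LieCrossedExtHomOver.prod {hE' : IsLieCrossedExt E'} {hF' : IsLieCrossedExt F'}
    {φ : A →ₗ[K] C} {ψ : A →ₗ[K] D} (p : LieCrossedExtHomOver φ E E')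
    (q : LieCrossedExtHomOver ψ E F') :
    LieCrossedExtHomOver (φ.prod ψ) E (directSumExtData E' F' hE' hF') where
  β :=
    { toFun := fun x => ⟨(p.β x, q.β x), (p.π_β x).trans (q.π_β x).symm⟩
      map_add' := fun _ _ => Subtype.ext (Prod.ext (map_add p.β _ _) (map_add q.β _ _))
      map_smul' := fun _ _ => Subtype.ext (Prod.ext (map_smul p.β _ _) (map_smul q.β _ _))
      map_lie' := fun {_ _} =>
        Subtype.ext (Prod.ext (LieHom.map_lie p.β _ _) (LieHom.map_lie q.β _ _)) }
  δV := p.δV.prod q.δV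
  δMod i := (p.δMod i).prod (q.δMod i)
  π_β x := p.π_β x
  d1_δV v := Subtype.ext (Prod.ext (p.d1_δV v) (q.d1_δV v))
  δV_lie x v := Prod.ext (p.δV_lie x v) (q.δV_lie x v)
  δV_d2 m := Prod.ext (p.δV_d2 m) (q.δV_d2 m)
  δMod_d j hj m := Prod.ext (p.δMod_d j hj m) (q.δMod_d j hj m)
  δMod_lie j hj x m := Prod.ext (p.δMod_lie j hj x m) (q.δMod_lie j hj x m)
  δMod_e m := Prod.ext (p.δMod_e m) (q.δMod_e m)

/-- The identity morphism of a crossed extension. -/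
def LieCrossedExtHomOver.refl (E : LieCrossedExtData K g A t) :
    LieCrossedExtHomOver LinearMap.id E E where
  β := LieHom.id
  δV := LinearMap.id
  δMod _ := LinearMap.id
  π_β _ := rfl
  d1_δV _ := rfl
  δV_lie _ _ := rfl
  δV_d2 _ := rfl
  δMod_d _ _ _ := rfl
  δMod_lie _ _ _ _ := rfl
  δMod_e _ := rfl

/-- The first projection from a direct sum of crossed extensions. -/
def directSumFst (hE : IsLieCrossedExt E) (hF : IsLieCrossedExt F) :
    LieCrossedExtHomOver (LinearMap.fst K A B) (directSumExtData E F hE hF) E where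
  β := (LieHom.fst K E.L F.L).comp (fiberedProduct E F).incl
  δV := LinearMap.fst K _ _
  δMod _ := LinearMap.fst K _ _
  π_β _ := rfl
  d1_δV _ := rfl
  δV_lie _ _ := rfl
  δV_d2 _ := rfl
  δMod_d _ _ _ := rfl
  δMod_lie _ _ _ _ := rfl
  δMod_e _ := rfl

/-- The second projection from a direct sum of crossed extensions. -/
def directSumSnd (hE : IsLieCrossedExt E) (hF : IsLieCrossedExt F) :
    LieCrossedExtHomOver (LinearMap.snd K A B) (directSumExtData E F hE hF) F where
  β := (LieHom.snd K E.L F.L).comp (fiberedProduct E F).incl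
  δV := LinearMap.snd K _ _
  δMod _ := LinearMap.snd K _ _
  π_β x := (mem_fiberedProduct.1 x.2).symm
  d1_δV _ := rfl
  δV_lie _ _ := rfl
  δV_d2 _ := rfl
  δMod_d _ _ _ := rfl
  δMod_lie _ _ _ _ := rfl
  δMod_e _ := rfl

end DirectSumHoms

section Pushforward

variable {u : ℕ}

/-- The map from the coefficient module to the `i`-th module: `e` at the top, the injection `f`
just below it, and zero elsewhere. -/
def coeffMap (E : LieCrossedExtData K g A (u + 1)) : ∀ i, A →ₗ[K] E.Mod i :=
  Function.update (Function.update (fun _ => 0) u (E.d u ∘ₗ E.e)) (u + 1) E.e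

theorem coeffMap_top (E : LieCrossedExtData K g A (u + 1)) : coeffMap E (u + 1) = E.e := by
  simp [coeffMap]

theorem coeffMap_self (E : LieCrossedExtData K g A (u + 1)) :
    coeffMap E u = E.d u ∘ₗ E.e := by
  simp [coeffMap]

theorem coeffMap_of_ne (E : LieCrossedExtData K g A (u + 1)) {i : ℕ} (h : i ≠ u)
    (h' : i ≠ u + 1) : coeffMap E i = 0 := by
  simp [coeffMap, h, h']

variable {E : LieCrossedExtData K g A (u + 1)}

theorem d2_coeffMap (hE : IsLieCrossedExt E) (a : A) : E.d2 (coeffMap E 0 a) = 0 := by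
  obtain ⟨-, -, -, -, -, h6, -⟩ := hE
  have h6 := h6 (by omega)
  rcases Nat.eq_zero_or_pos u with rfl | hu
  · rw [coeffMap_self]
    exact (h6.ge ⟨_, rfl⟩ :)
  · rw [coeffMap_of_ne _ (by omega) (by omega)]
    simp

theorem d_coeffMap (hE : IsLieCrossedExt E) {j : ℕ} (hj : j ≤ u) (a : A) :
    E.d j (coeffMap E (j + 1) a) = coeffMap E j a := by
  obtain ⟨-, -, -, -, -, -, h7, -⟩ := hE
  rcases hj.eq_or_lt with rfl | hj
  · rw [coeffMap_top, coeffMap_self]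
    rfl
  · rw [coeffMap_of_ne E hj.ne (by omega)]
    rcases (Nat.succ_le_of_lt hj).eq_or_lt with rfl | hj'
    · rw [coeffMap_self]
      exact ((h7 j (by omega)).ge ⟨_, rfl⟩ :)
    · rw [coeffMap_of_ne E (by omega) (by omega)]
      simp

theorem coeffMap_lie (hE : IsLieCrossedExt E) (i : ℕ) (x : g) (a : A) :
    coeffMap E i ⁅x, a⁆ = ⁅x, coeffMap E i a⁆ := by
  obtain ⟨-, -, -, -, -, -, -, -, -, -, h11, h12⟩ := hE
  by_cases h : i = u + 1
  · subst h
    rw [coeffMap_top]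
    exact h12 x a
  by_cases h' : i = u
  · subst h'
    rw [coeffMap_self]
    simp [h11 i (by omega), h12]
  · simp [coeffMap_of_ne E h' h]

theorem LieCrossedExtHomOver.δMod_coeffMap {F : LieCrossedExtData K g B (u + 1)}
    {φ : A →ₗ[K] B} (p : LieCrossedExtHomOver φ E F) (i : ℕ) (a : A) :
    p.δMod i (coeffMap E i a) = coeffMap F i (φ a) := by
  by_cases h : i = u + 1
  · subst h
    rw [coeffMap_top, coeffMap_top]
    exact p.δMod_e a
  by_cases h' : i = u
  · subst h'
    rw [coeffMap_self, coeffMap_self]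
    simp [p.δMod_d i (by omega), p.δMod_e]
  · simp [coeffMap_of_ne _ h' h]

/-- The submodules of `E.Mod i × B` used to build the pushforward of `E` along `φ`: the quotient
is `E.Mod i` below level `u`, the pushout at level `u`, and a copy of `B` at level `u + 1`. -/
def pushSub (hE : IsLieCrossedExt E) (φ : A →ₗ⁅K, g⁆ B) (i : ℕ) :
    LieSubmodule K g (E.Mod i × B) where
  carrier := {p | ∃ a, p.1 = coeffMap E i a ∧ (u ≤ i → p.2 = -φ a) ∧ (u + 1 < i → a = 0)}
  add_mem' := by
    rintro p q ⟨a, h1, h2, h3⟩ ⟨b, k1, k2, k3⟩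
    refine ⟨a + b, by simp [h1, k1], fun h => ?_, fun h => by simp [h3 h, k3 h]⟩
    simp only [Prod.snd_add, h2 h, k2 h, map_add]
    abel
  zero_mem' := ⟨0, by simp⟩
  smul_mem' := by
    rintro c p ⟨a, h1, h2, h3⟩
    exact ⟨c • a, by simp [h1], fun h => by simp [h2 h], fun h => by simp [h3 h]⟩
  lie_mem := by
    rintro x p ⟨a, h1, h2, h3⟩
    refine ⟨⁅x, a⁆, ?_, fun h => ?_, fun h => by simp [h3 h]⟩
    · simp only [prod_lie_apply, h1, coeffMap_lie hE]
    · simp only [prod_lie_apply, h2 h, lie_neg, LieModuleHom.map_lie]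

theorem mem_pushSub {hE : IsLieCrossedExt E} {φ : A →ₗ⁅K, g⁆ B} {i : ℕ} {p : E.Mod i × B} :
    p ∈ pushSub hE φ i ↔
      ∃ a, p.1 = coeffMap E i a ∧ (u ≤ i → p.2 = -φ a) ∧ (u + 1 < i → a = 0) :=
  Iff.rfl

theorem mem_pushSub_of_lt {hE : IsLieCrossedExt E} {φ : A →ₗ⁅K, g⁆ B} {i : ℕ} (hi : i < u)
    {p : E.Mod i × B} : p ∈ pushSub hE φ i ↔ p.1 = 0 := by
  rw [mem_pushSub, coeffMap_of_ne E hi.ne (by omega)]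
  constructor
  · rintro ⟨a, h, -⟩
    exact h
  · exact fun h => ⟨0, h, fun _ => by omega, fun _ => rfl⟩

theorem pushSub_le_comap (hE : IsLieCrossedExt E) (φ : A →ₗ⁅K, g⁆ B) (i : ℕ) :
    (pushSub hE φ (i + 1)).toSubmodule ≤
      (pushSub hE φ i).toSubmodule.comap ((E.d i).prodMap LinearMap.id) := by
  rintro ⟨y, b⟩ ⟨a, h1, h2, h3⟩
  simp only at h1 h2
  subst h1
  by_cases hi : i ≤ u
  · rw [Submodule.mem_comap]
    refine ⟨a, d_coeffMap hE hi a, fun h => h2 (by omega), fun h => by omega⟩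
  · obtain rfl := h3 (by omega)
    exact ⟨0, by simp, fun _ => h2 (by omega), fun _ => rfl⟩

/-- The data of the pushforward `φ_* E` of a crossed extension of `g` by `A` along a morphism
`φ : A → B` of `g`-modules. -/
noncomputable def pushExtData (hE : IsLieCrossedExt E) (φ : A →ₗ⁅K, g⁆ B) :
    LieCrossedExtData K g B (u + 1) where
  L := E.L
  V := E.V
  Mod i := (E.Mod i × B) ⧸ pushSub hE φ i
  π := E.π
  d1 := E.d1
  d2 := (pushSub hE φ 0).toSubmodule.liftQ (E.d2 ∘ₗ LinearMap.fst K _ _) (by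
    rintro ⟨y, b⟩ ⟨a, h1, -⟩
    simp only at h1
    simp [h1, d2_coeffMap hE])
  d i := Submodule.mapQ _ _ ((E.d i).prodMap LinearMap.id) (pushSub_le_comap hE φ i)
  e := LinearEquiv.ofBijective ((pushSub hE φ (u + 1)).toSubmodule.mkQ ∘ₗ LinearMap.inr K _ _) (by
    constructor
    · rw [← LinearMap.ker_eq_bot, LinearMap.ker_eq_bot']
      intro b hb
      obtain ⟨a, h1, h2, -⟩ := (Submodule.Quotient.mk_eq_zero _).1 hb
      have ha : a = 0 := by
        rw [coeffMap_top] at h1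
        exact (map_eq_zero_iff E.e E.e.injective).1 h1.symm
      simpa [ha] using h2 (by omega)
    · intro q
      obtain ⟨⟨y, b⟩, rfl⟩ := Submodule.mkQ_surjective _ q
      refine ⟨b + φ (E.e.symm y), ?_⟩
      refine ((Submodule.Quotient.eq _).2 ⟨-E.e.symm y, ?_, fun _ => ?_, fun h => by omega⟩)
      · simp [coeffMap_top]
      · simp)

/-- The projection onto the modules of the pushforward. -/
def pushMk (hE : IsLieCrossedExt E) (φ : A →ₗ⁅K, g⁆ B) (i : ℕ) :
    E.Mod i × B →ₗ[K] (pushExtData hE φ).Mod i :=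
  (pushSub hE φ i).toSubmodule.mkQ

theorem pushExtData_lie_mk (hE : IsLieCrossedExt E) (φ : A →ₗ⁅K, g⁆ B) (i : ℕ) (x : g)
    (p : E.Mod i × B) :
    (⁅x, pushMk hE φ i p⁆ : (pushExtData hE φ).Mod i) =
      pushMk hE φ i ⁅x, p⁆ := rfl

theorem pushExtData_d_mk (hE : IsLieCrossedExt E) (φ : A →ₗ⁅K, g⁆ B) (i : ℕ)
    (p : E.Mod (i + 1) × B) :
    (pushExtData hE φ).d i (pushMk hE φ (i + 1) p) =
      pushMk hE φ i (E.d i p.1, p.2) := rfl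

theorem pushExtData_mk_surjective (hE : IsLieCrossedExt E) (φ : A →ₗ⁅K, g⁆ B) {i : ℕ}
    (q : (pushExtData hE φ).Mod i) :
    ∃ p, pushMk hE φ i p = q :=
  Submodule.mkQ_surjective _ q

theorem pushExtData_mk_eq_zero (hE : IsLieCrossedExt E) (φ : A →ₗ⁅K, g⁆ B) {i : ℕ}
    {p : E.Mod i × B} :
    pushMk hE φ i p = (0 : (pushExtData hE φ).Mod i) ↔ p ∈ pushSub hE φ i :=
  Submodule.Quotient.mk_eq_zero _

theorem isLieCrossedExt_pushExtData (hE : IsLieCrossedExt E) (φ : A →ₗ⁅K, g⁆ B) :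
    IsLieCrossedExt (pushExtData hE φ) := by
  obtain ⟨a1, a2, a3, a4, a5, a6, a7, a8, a9, a10, a11, a12⟩ := id hE
  refine ⟨a1, a2, a3, a4, ?_, ?_, ?_, fun h => by omega, ?_, ?_, ?_, ?_⟩
  · refine a5.trans ?_
    ext v
    constructor
    · rintro ⟨m, rfl⟩
      exact ⟨pushMk hE φ 0 (m, 0), rfl⟩
    · rintro ⟨q, rfl⟩
      obtain ⟨p, rfl⟩ := pushExtData_mk_surjective hE φ q
      exact ⟨p.1, rfl⟩
  · intro h
    have a6 := a6 h
    ext q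
    constructor
    · obtain ⟨⟨y, b⟩, rfl⟩ := pushExtData_mk_surjective hE φ q
      intro hq
      have hy : y ∈ LinearMap.ker E.d2 := hq
      rw [a6] at hy
      obtain ⟨z, rfl⟩ := hy
      exact ⟨pushMk hE φ 1 (z, b), rfl⟩
    · rintro ⟨q, rfl⟩
      obtain ⟨p, rfl⟩ := pushExtData_mk_surjective hE φ q
      exact (a6.ge ⟨p.1, rfl⟩ :)
  · intro j hj
    have a7 := a7 j hj
    ext q
    rw [LinearMap.mem_ker]
    constructor
    · obtain ⟨⟨y, b⟩, rfl⟩ := pushExtData_mk_surjective hE φ q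
      intro hq
      rw [pushExtData_d_mk, pushExtData_mk_eq_zero, mem_pushSub_of_lt (by omega)] at hq
      have hy : y ∈ LinearMap.ker (E.d j) := hq
      rw [a7] at hy
      obtain ⟨z, rfl⟩ := hy
      exact ⟨pushMk hE φ (j + 2) (z, b), rfl⟩
    · rintro ⟨q, rfl⟩
      obtain ⟨p, rfl⟩ := pushExtData_mk_surjective hE φ q
      rw [pushExtData_d_mk, pushExtData_d_mk, pushExtData_mk_eq_zero,
        mem_pushSub_of_lt (by omega)]
      exact (a7.ge ⟨p.1, rfl⟩ :)
  · intro k hk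
    obtain rfl : k = u := by omega
    rw [← LinearMap.ker_eq_bot, LinearMap.ker_eq_bot']
    intro q hq
    obtain ⟨⟨y, b⟩, rfl⟩ := pushExtData_mk_surjective hE φ q
    rw [pushExtData_d_mk, pushExtData_mk_eq_zero] at hq
    rw [pushExtData_mk_eq_zero]
    obtain ⟨a, h1, h2, -⟩ := hq
    refine ⟨a, ?_, fun _ => h2 le_rfl, fun h => by omega⟩
    rw [coeffMap_top]
    rw [coeffMap_self] at h1
    exact a9 k rfl h1
  · intro x q
    obtain ⟨p, rfl⟩ := pushExtData_mk_surjective hE φ q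
    exact a10 x p.1
  · intro j hj x q
    obtain ⟨p, rfl⟩ := pushExtData_mk_surjective hE φ q
    rw [pushExtData_lie_mk, pushExtData_d_mk, pushExtData_d_mk, pushExtData_lie_mk]
    simp only [prod_lie_apply, a11 j hj]
  · intro x b
    change pushMk hE φ (u + 1) (0, ⁅x, b⁆) =
      (⁅x, pushMk hE φ (u + 1) (0, b)⁆ : (pushExtData hE φ).Mod (u + 1))
    rw [pushExtData_lie_mk, prod_lie_apply, lie_zero]

/-- The canonical morphism from a crossed extension to its pushforward. -/
noncomputable def pushHom (hE : IsLieCrossedExt E) (φ : A →ₗ⁅K, g⁆ B) :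
    LieCrossedExtHomOver (φ : A →ₗ[K] B) E (pushExtData hE φ) where
  β := LieHom.id
  δV := LinearMap.id
  δMod i := pushMk hE φ i ∘ₗ LinearMap.inl K _ _
  π_β _ := rfl
  d1_δV _ := rfl
  δV_lie _ _ := rfl
  δV_d2 _ := rfl
  δMod_d _ _ _ := rfl
  δMod_lie j _ x m := by
    change pushMk hE φ j (⁅x, m⁆, 0) =
      (⁅x, pushMk hE φ j (m, 0)⁆ : (pushExtData hE φ).Mod j)
    rw [pushExtData_lie_mk, prod_lie_apply, lie_zero]
  δMod_e a := (Submodule.Quotient.eq _).2 ⟨a, by simp [coeffMap_top], fun _ => by simp,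
    fun h => by omega⟩

/-- The universal property of the pushforward of a crossed extension. -/
noncomputable def pushLift (hE : IsLieCrossedExt E) (φ : A →ₗ⁅K, g⁆ B)
    {G : LieCrossedExtData K g B (u + 1)} (hG : IsLieCrossedExt G)
    (p : LieCrossedExtHomOver (φ : A →ₗ[K] B) E G) :
    LieCrossedExtHomOver LinearMap.id (pushExtData hE φ) G where
  β := p.β
  δV := p.δV
  δMod i := (pushSub hE φ i).toSubmodule.liftQ ((p.δMod i).coprod (coeffMap G i)) (by
    rintro ⟨y, b⟩ ⟨a, h1, h2, -⟩
    simp only at h1 h2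
    rw [LinearMap.mem_ker, LinearMap.coprod_apply, h1, p.δMod_coeffMap]
    by_cases hi : u ≤ i
    · rw [h2 hi]
      simp
    · rw [coeffMap_of_ne G (by omega) (by omega)]
      simp)
  π_β := p.π_β
  d1_δV := p.d1_δV
  δV_lie := p.δV_lie
  δV_d2 q := by
    obtain ⟨⟨y, b⟩, rfl⟩ := pushExtData_mk_surjective hE φ q
    change p.δV (E.d2 y) = G.d2 (p.δMod 0 y + coeffMap G 0 b)
    rw [map_add, d2_coeffMap hG, add_zero, p.δV_d2]
  δMod_d j hj q := by
    obtain ⟨⟨y, b⟩, rfl⟩ := pushExtData_mk_surjective hE φ q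
    change p.δMod j (E.d j y) + coeffMap G j b =
      G.d j (p.δMod (j + 1) y + coeffMap G (j + 1) b)
    rw [map_add, d_coeffMap hG (by omega), p.δMod_d j hj]
  δMod_lie j hj x q := by
    obtain ⟨⟨y, b⟩, rfl⟩ := pushExtData_mk_surjective hE φ q
    change p.δMod j ⁅x, y⁆ + coeffMap G j ⁅x, b⁆ = ⁅x, p.δMod j y + coeffMap G j b⁆
    rw [lie_add, coeffMap_lie hG, p.δMod_lie j hj]
  δMod_e b := by
    change p.δMod (u + 1) 0 + coeffMap G (u + 1) b = G.e b
    rw [map_zero, zero_add, coeffMap_top]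
    rfl

end Pushforward

section BaerSum

variable {u : ℕ}

/-- The codiagonal `∇_M : M ⊕ M → M`. -/
def codiag (K g M : Type) [Field K] [LieRing g] [LieAlgebra K g] [AddCommGroup M] [Module K M]
    [LieRingModule g M] [LieModule K g M] : M × M →ₗ⁅K, g⁆ M where
  __ := LinearMap.coprod LinearMap.id LinearMap.id
  map_lie' {x p} := (lie_add x p.1 p.2).symm

theorem codiag_apply (p : M × M) : codiag K g M p = p.1 + p.2 := rfl

theorem nonempty_homOver_of_isBaerSum {E E' F : LieCrossedExtData K g M (u + 1)}
    (hE : IsLieCrossedExt E) (hE' : IsLieCrossedExt E') (hF : IsLieCrossedExt F)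
    (h : IsBaerSum u E E' F) :
    Nonempty (LieCrossedExtHomOver (codiag K g M : M × M →ₗ[K] M)
      (directSumExtData E E' hE hE') F) := by
  obtain ⟨jL, eV, eMod, r, j_inj, j_range, j_lie, j_π, eV_lie, eV_d1, eMod_lie, eV_d2, eV_d2',
    eMod_d, r_surj, r_lie, r_ker, r_d, r_e⟩ := h
  have e_lie := hE.2.2.2.2.2.2.2.2.2.2.2
  have e_lie' := hE'.2.2.2.2.2.2.2.2.2.2.2
  have f_lie := hF.2.2.2.2.2.2.2.2.2.2.2
  have j_ex : ∀ x : fiberedProduct E E', ∃ y : F.L, jL y = x.1 := fun x =>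
    (j_range.ge x.2 :)
  choose b hb using j_ex
  let top : E.Mod (u + 1) × E'.Mod (u + 1) →ₗ[K] F.Mod (u + 1) :=
    F.e.toLinearMap ∘ₗ (codiag K g M).toLinearMap ∘ₗ
      (E.e.symm.toLinearMap.prodMap E'.e.symm.toLinearMap)
  have top_apply : ∀ m n, top (E.e m, E'.e n) = F.e (m + n) := fun m n => by
    simp [top, codiag_apply]
  let δ : ∀ i, E.Mod i × E'.Mod i →ₗ[K] F.Mod i :=
    Function.update (Function.update
      (fun i => if h : i < u then (eMod i h).symm.toLinearMap else 0) u r) (u + 1) top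
  have δ_top : δ (u + 1) = top := by simp [δ]
  have δ_self : δ u = r := by simp [δ]
  have δ_lt : ∀ i (h : i < u), δ i = (eMod i h).symm.toLinearMap := fun i h => by
    simp [δ, h, h.ne, show i ≠ u + 1 by omega]
  let β : fiberedProduct E E' →ₗ⁅K⁆ F.L :=
    { toFun := b
      map_add' := fun x y => j_inj (by rw [map_add, hb, hb, hb]; rfl)
      map_smul' := fun c x => j_inj (by rw [map_smul, hb, hb]; rfl)
      map_lie' := fun {x y} => j_inj (by rw [j_lie, hb, hb, hb]; rfl) }
  have j_β : ∀ x, jL (β x) = x.1 := hb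
  refine ⟨⟨β, eV.symm.toLinearMap, δ, ?_, ?_, ?_, ?_, ?_, ?_, ?_⟩⟩
  · exact fun x => (j_π _).trans (congrArg (fun p => E.π p.1) (j_β x))
  · rintro ⟨v, w⟩
    refine j_inj (Eq.trans ?_ (j_β _).symm)
    change jL (F.d1 (eV.symm (v, w))) = (E.d1 v, E'.d1 w)
    rw [eV_d1, LinearEquiv.apply_symm_apply]
  · rintro x ⟨v, w⟩
    apply eV.injective
    change eV (eV.symm (⁅x.1.1, v⁆, ⁅x.1.2, w⁆)) = eV ⁅β x, eV.symm (v, w)⁆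
    rw [eV_lie, LinearEquiv.apply_symm_apply, LinearEquiv.apply_symm_apply]
    exact congrArg (fun p : E.L × E'.L => (⁅p.1, v⁆, ⁅p.2, w⁆)) (j_β x).symm
  · rintro ⟨m, n⟩
    apply eV.injective
    change eV (eV.symm (E.d2 m, E'.d2 n)) = eV (F.d2 (δ 0 (m, n)))
    rw [LinearEquiv.apply_symm_apply]
    rcases Nat.eq_zero_or_pos u with rfl | hu
    · rw [δ_self]
      exact (eV_d2' rfl (m, n)).symm
    · rw [eV_d2 hu, δ_lt 0 hu, LinearEquiv.coe_coe, LinearEquiv.apply_symm_apply]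
  · rintro j hj ⟨m, n⟩
    change δ j (E.d j m, E'.d j n) = F.d j (δ (j + 1) (m, n))
    rcases (Nat.le_of_lt_succ hj).eq_or_lt with rfl | hj
    · obtain ⟨m, rfl⟩ := E.e.surjective m
      obtain ⟨n, rfl⟩ := E'.e.surjective n
      rw [δ_self, δ_top, top_apply, r_e, ← sub_eq_zero, ← map_sub, ← LinearMap.mem_ker, r_ker]
      refine ⟨-n, ?_⟩
      simp
    · rw [δ_lt j hj]
      apply (eMod j hj).injective
      change eMod j hj ((eMod j hj).symm _) = _
      rw [LinearEquiv.apply_symm_apply]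
      rcases (Nat.succ_le_of_lt hj).eq_or_lt with rfl | hj'
      · rw [δ_self]
        exact (r_d j rfl (m, n)).symm
      · rw [δ_lt (j + 1) hj', eMod_d j hj', LinearEquiv.coe_coe, LinearEquiv.apply_symm_apply]
  · rintro j hj x ⟨m, n⟩
    change δ j (⁅x, m⁆, ⁅x, n⁆) = ⁅x, δ j (m, n)⁆
    rcases hj.eq_or_lt with rfl | hj
    · obtain ⟨m, rfl⟩ := E.e.surjective m
      obtain ⟨n, rfl⟩ := E'.e.surjective n
      rw [δ_top]
      change top (⁅x, E.e m⁆, ⁅x, E'.e n⁆) = ⁅x, top (E.e m, E'.e n)⁆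
      rw [← e_lie, ← e_lie', top_apply, top_apply, ← f_lie, lie_add]
    rcases (Nat.le_of_lt_succ hj).eq_or_lt with rfl | hj
    · rw [δ_self]
      exact r_lie x (m, n)
    · rw [δ_lt j hj]
      apply (eMod j hj).injective
      change eMod j hj ((eMod j hj).symm _) = eMod j hj ⁅x, (eMod j hj).symm (m, n)⁆
      rw [eMod_lie, LinearEquiv.apply_symm_apply, LinearEquiv.apply_symm_apply]
  · intro m
    rw [δ_top]
    exact top_apply m.1 m.2

/-- The Baer sum `∇_M (E ⊕_g E')`. -/
noncomputable def baerSum (E E' : LieCrossedExt K g M (u + 1)) : LieCrossedExt K g M (u + 1) :=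
  ⟨pushExtData (isLieCrossedExt_directSumExtData E.2 E'.2) (codiag K g M),
    isLieCrossedExt_pushExtData _ _⟩

/-- The canonical morphism from the direct sum to the Baer sum. -/
noncomputable def toBaerSum (E E' : LieCrossedExt K g M (u + 1)) :
    LieCrossedExtHomOver (codiag K g M : M × M →ₗ[K] M)
      (directSumExtData E.1 E'.1 E.2 E'.2) (baerSum E E').1 :=
  pushHom _ _

theorem baerSum_rel {E E' G : LieCrossedExt K g M (u + 1)}
    (p : LieCrossedExtHomOver (codiag K g M : M × M →ₗ[K] M)
      (directSumExtData E.1 E'.1 E.2 E'.2) G.1) :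
    lieCrossedExtRel K g M (u + 1) (baerSum E E') G :=
  (pushLift _ _ G.2 p).rel

theorem mk_eq_mk_of_homOver {X : LieCrossedExtData K g A (u + 1)} (hX : IsLieCrossedExt X)
    (φ : A →ₗ⁅K, g⁆ M) {E F : LieCrossedExt K g M (u + 1)}
    (p : LieCrossedExtHomOver (φ : A →ₗ[K] M) X E.1)
    (q : LieCrossedExtHomOver (φ : A →ₗ[K] M) X F.1) :
    (Quot.mk _ E : Opext K g M (u + 1)) = Quot.mk _ F := by
  let P : LieCrossedExt K g M (u + 1) := ⟨pushExtData hX φ, isLieCrossedExt_pushExtData hX φ⟩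
  have h1 : lieCrossedExtRel K g M (u + 1) P E := (pushLift hX φ E.2 p).rel
  have h2 : lieCrossedExtRel K g M (u + 1) P F := (pushLift hX φ F.2 q).rel
  exact (Quot.sound h1).symm.trans (Quot.sound h2)

theorem isLieCrossedExt_zeroExtData : IsLieCrossedExt (zeroExtData K g M (u + 1)) := by
  have hV : ∀ v : (zeroExtData K g M (u + 1)).V, v = 0 := fun v => by
    obtain ⟨m, rfl⟩ := Submodule.mkQ_surjective _ v
    exact (Submodule.Quotient.mk_eq_zero _).2 trivial
  have hMod : ∀ i < u, ∀ m : (zeroExtData K g M (u + 1)).Mod i, m = 0 := fun i hi v => by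
    obtain ⟨m, rfl⟩ := Submodule.mkQ_surjective _ v
    refine (Submodule.Quotient.mk_eq_zero _).2 ?_
    simp [zeroSub, show ¬ u + 1 ≤ i + 1 by omega]
  have hsurj : ∀ i, Function.Surjective ((zeroExtData K g M (u + 1)).d i) := fun i v => by
    obtain ⟨m, rfl⟩ := Submodule.mkQ_surjective _ v
    exact ⟨(zeroSub K g M (u + 1) (i + 1)).toSubmodule.mkQ m, rfl⟩
  refine ⟨?_, ?_, ?_, ?_, ?_, ?_, ?_, fun h => by omega, ?_, ?_, ?_, ?_⟩
  · exact fun x v => (lie_zero x).symm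
  · exact fun v w => (hV _).trans (hV _).symm
  · exact fun x => ⟨x, rfl⟩
  · intro x
    constructor
    · rintro rfl
      exact zero_mem _
    · rintro ⟨v, rfl⟩
      rfl
  · ext v
    rw [hV v]
    exact ⟨fun _ => zero_mem _, fun _ => zero_mem _⟩
  · intro _
    rw [LinearMap.range_eq_top.2 (hsurj 0)]
    exact LinearMap.ker_zero
  · intro j hj
    rw [LinearMap.range_eq_top.2 (hsurj (j + 1)), LinearMap.ker_eq_top]
    ext m
    exact hMod j (by omega) _
  · intro k hk
    obtain rfl : k = u := by omega
    rw [← LinearMap.ker_eq_bot, LinearMap.ker_eq_bot']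
    intro v hv
    obtain ⟨m, rfl⟩ := Submodule.mkQ_surjective _ v
    refine (Submodule.Quotient.mk_eq_zero _).2 ?_
    have := (Submodule.Quotient.mk_eq_zero _).1 hv
    simpa [zeroSub] using this
  · exact fun x m => (hV _).trans (hV _).symm
  · intro j hj x v
    obtain ⟨m, rfl⟩ := Submodule.mkQ_surjective _ v
    rfl
  · exact fun x m => rfl

/-- The zero crossed extension. -/
def zeroExt (K g M : Type) [Field K] [LieRing g] [LieAlgebra K g] [AddCommGroup M] [Module K M]
    [LieRingModule g M] [LieModule K g M] (u : ℕ) : LieCrossedExt K g M (u + 1) :=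
  ⟨zeroExtData K g M (u + 1), isLieCrossedExt_zeroExtData⟩


/-- The projection of a crossed extension onto the zero extension, over the zero map. -/
def toZeroExt {E : LieCrossedExtData K g A (u + 1)} (hE : IsLieCrossedExt E) :
    LieCrossedExtHomOver (0 : A →ₗ[K] M) E (zeroExt K g M u).1 where
  β := E.π
  δV := 0
  δMod _ := 0
  π_β _ := rfl
  d1_δV v := ((hE.2.2.2.1 (E.d1 v)).2 ⟨v, rfl⟩).symm
  δV_lie _ _ := (lie_zero _).symm
  δV_d2 _ := (map_zero _).symm
  δMod_d _ _ _ := (map_zero _).symm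
  δMod_lie _ _ _ _ := (lie_zero _).symm
  δMod_e _ := (map_zero _).symm

theorem isLieCrossedExt_negExtData {E : LieCrossedExtData K g M (u + 1)}
    (hE : IsLieCrossedExt E) : IsLieCrossedExt (negExtData E) := by
  obtain ⟨a1, a2, a3, a4, a5, a6, a7, a8, a9, a10, a11, a12⟩ := hE
  refine ⟨a1, a2, a3, a4, a5, a6, a7, a8, a9, a10, a11, fun x m => ?_⟩
  change E.e (-⁅x, m⁆) = ⁅x, E.e (-m)⁆
  rw [← lie_neg, a12]

/-- The negative of a crossed extension. -/
def negExt (E : LieCrossedExt K g M (u + 1)) : LieCrossedExt K g M (u + 1) :=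
  ⟨negExtData E.1, isLieCrossedExt_negExtData E.2⟩

/-- The identity, as a morphism from a crossed extension to its negative over `-1`. -/
def toNegExt (E : LieCrossedExt K g M (u + 1)) :
    LieCrossedExtHomOver (-LinearMap.id : M →ₗ[K] M) E.1 (negExt E).1 where
  __ := LieCrossedExtHomOver.refl E.1
  δMod_e m := congrArg E.1.e (neg_neg m).symm

/-- Functoriality of the negative of a crossed extension. -/
def LieCrossedExtHomOver.neg {E F : LieCrossedExt K g M (u + 1)}
    (p : LieCrossedExtHomOver LinearMap.id E.1 F.1) :
    LieCrossedExtHomOver LinearMap.id (negExt E).1 (negExt F).1 where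
  __ := p
  δMod_e m := p.δMod_e (-m)

namespace Opext

/-- Addition of classes of crossed extensions. -/
noncomputable def add : Opext K g M (u + 1) → Opext K g M (u + 1) → Opext K g M (u + 1) :=
  Quot.map₂ baerSum
    (fun E _ F' h => by
      obtain ⟨p⟩ := LieCrossedExtHomOver.nonempty_of_rel h
      exact baerSum_rel (((toBaerSum E F').comp
        ((LieCrossedExtHomOver.refl E.1).prodMap p)).congr fun _ => rfl))
    (fun _ E' F h => by
      obtain ⟨p⟩ := LieCrossedExtHomOver.nonempty_of_rel h
      exact baerSum_rel (((toBaerSum E' F).comp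
        (p.prodMap (LieCrossedExtHomOver.refl F.1))).congr fun _ => rfl))

/-- The negative of a class of crossed extensions. -/
def neg : Opext K g M (u + 1) → Opext K g M (u + 1) :=
  Quot.map negExt fun _ _ h => by
    obtain ⟨p⟩ := LieCrossedExtHomOver.nonempty_of_rel h
    exact p.neg.rel

theorem add_mk (E F : LieCrossedExt K g M (u + 1)) :
    add (Quot.mk _ E) (Quot.mk _ F) = Quot.mk _ (baerSum E F) := rfl

theorem add_comm (x y : Opext K g M (u + 1)) : add x y = add y x := by
  induction x using Quot.ind with | _ E =>
  induction y using Quot.ind with | _ F =>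
  rw [add_mk, add_mk]
  exact Quot.sound (baerSum_rel (((toBaerSum F E).comp
    ((directSumSnd E.2 F.2).prod (directSumFst E.2 F.2))).congr
      fun p => _root_.add_comm p.2 p.1))

theorem zero_add (x : Opext K g M (u + 1)) : add (Quot.mk _ (zeroExt K g M u)) x = x := by
  induction x using Quot.ind with | _ E =>
  rw [add_mk]
  let p : LieCrossedExtHomOver LinearMap.id E.1 (baerSum (zeroExt K g M u) E).1 :=
    ((toBaerSum (zeroExt K g M u) E).comp
      ((toZeroExt E.2).prod (LieCrossedExtHomOver.refl E.1))).congr fun m => _root_.zero_add m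
  exact (Quot.sound p.rel).symm

theorem neg_add (x : Opext K g M (u + 1)) :
    add (neg x) x = Quot.mk _ (zeroExt K g M u) := by
  induction x using Quot.ind with | _ E =>
  change add (Quot.mk _ (negExt E)) _ = _
  rw [add_mk]
  exact mk_eq_mk_of_homOver E.2 0 (((toBaerSum (negExt E) E).comp
    ((toNegExt E).prod (LieCrossedExtHomOver.refl E.1))).congr
      fun m => neg_add_cancel m) ((toZeroExt E.2).congr fun _ => rfl)

theorem add_assoc (x y z : Opext K g M (u + 1)) : add (add x y) z = add x (add y z) := by
  induction x using Quot.ind with | _ E =>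
  induction y using Quot.ind with | _ F =>
  induction z using Quot.ind with | _ G =>
  simp only [add_mk]
  have hEF := isLieCrossedExt_directSumExtData E.2 F.2
  let φ : (M × M) × M →ₗ⁅K, g⁆ M :=
    { (codiag K g M).toLinearMap ∘ₗ (codiag K g M).toLinearMap.prodMap LinearMap.id with
      map_lie' := fun {x p} => by
        change ⁅x, p.1.1⁆ + ⁅x, p.1.2⁆ + ⁅x, p.2⁆ = ⁅x, p.1.1 + p.1.2 + p.2⁆
        rw [lie_add, lie_add] }
  refine mk_eq_mk_of_homOver (isLieCrossedExt_directSumExtData hEF G.2) φ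
    (((toBaerSum (baerSum E F) G).comp
      ((toBaerSum E F).prodMap (LieCrossedExtHomOver.refl G.1))).congr fun _ => rfl)
    (((toBaerSum E (baerSum F G)).comp
      (((directSumFst E.2 F.2).comp (directSumFst hEF G.2)).prod
        ((toBaerSum F G).comp (((directSumSnd E.2 F.2).comp (directSumFst hEF G.2)).prod
          (directSumSnd hEF G.2))))).congr
      fun p => (_root_.add_assoc p.1.1 p.1.2 p.2).symm)

theorem add_eq_of_isBaerSum {E E' F : LieCrossedExt K g M (u + 1)}
    (h : IsBaerSum u E.1 E'.1 F.1) : add (Quot.mk _ E) (Quot.mk _ E') = Quot.mk _ F := by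
  obtain ⟨p⟩ := nonempty_homOver_of_isBaerSum E.2 E'.2 F.2 h
  exact Quot.sound (baerSum_rel p)

end Opext

end BaerSum

end Helpers


/-- for `n = u + 3 ≥ 3`, the Baer sum `E + E' = ∇_M (E ⊕_g E')` makes
`Opextⁿ(g, M)` an abelian group, with zero element the class of the zero extension
`0 → M = M → 0 → ⋯ → 0 → g = g → 0` and with the inverse of the class of
`(0 → M →^f ⋯ → g → 0)` given by the class of `(0 → M →^{-f} ⋯ → g → 0)`. -/
theorem crossed_ext_stmt18 (u : ℕ) :
    ∃ inst : AddCommGroup (Opext K g M (u + 1)),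
      -- the zero element is the class of the zero extension,
      (∀ hz : IsLieCrossedExt (zeroExtData K g M (u + 1)),
        inst.zero = Quot.mk _ (⟨zeroExtData K g M (u + 1), hz⟩ : LieCrossedExt K g M (u + 1))) ∧
      -- the negative of a class is the class of the extension with f replaced by -f,
      (∀ (E : LieCrossedExtData K g M (u + 1)) (hE : IsLieCrossedExt E)
          (hNE : IsLieCrossedExt (negExtData E)),
        inst.neg (Quot.mk _ ⟨E, hE⟩) = Quot.mk _ (⟨negExtData E, hNE⟩ :
          LieCrossedExt K g M (u + 1))) ∧
      -- and addition is given by the Baer sum.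
      (∀ (E E' F : LieCrossedExtData K g M (u + 1)) (hE : IsLieCrossedExt E)
          (hE' : IsLieCrossedExt E') (hF : IsLieCrossedExt F),
        IsBaerSum u E E' F →
          inst.add (Quot.mk _ ⟨E, hE⟩) (Quot.mk _ ⟨E', hE'⟩) =
            Quot.mk _ (⟨F, hF⟩ : LieCrossedExt K g M (u + 1))) := by
  let _ : Zero (Opext K g M (u + 1)) := ⟨Quot.mk _ (zeroExt K g M u)⟩
  let _ : Add (Opext K g M (u + 1)) := ⟨Opext.add⟩
  let _ : Neg (Opext K g M (u + 1)) := ⟨Opext.neg⟩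
  refine ⟨{ add_assoc := Opext.add_assoc
            zero_add := Opext.zero_add
            add_zero := fun x => (Opext.add_comm x _).trans (Opext.zero_add x)
            neg_add_cancel := Opext.neg_add
            add_comm := Opext.add_comm
            nsmul := nsmulRec
            zsmul := zsmulRec }, fun _ => rfl, fun _ _ _ => rfl, ?_⟩
  exact fun E E' F hE hE' hF h => Opext.add_eq_of_isBaerSum h
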